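/- Let K be a field, e = g = 2, f = 4, and let 𝒫' = K[𝔟, v_{jk}, x_{ij}] (1 ≤ k ≤ 2, 1 ≤ j ≤ 4, 1 ≤ i ≤ 2) with ℛ' = 𝒫'/𝒥', where 𝒥' = I_1(XV) + ({det X(Ā) + ∇_{Ā,A} 𝔟 det V(A)}) over all 2-element subsets A of {1,2,3,4}. Then the minimal graded free resolution of ℛ' over 𝒫' has betti numbers (rank of the i-th free module) equal to 1, 10, 19, 19, 10, 1 for i = 0, 1, 2, 3, 4, 5; in particular the resolution is of length 5 = eg+1 and ℛ' is Gorenstein-symmetric in its betti numbers. -/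

import Mathlib

/- Example 7.10.  For `e = g = 2`, `f = 4`, `𝒫' = K[𝔟, v_{jk}, x_{ij}]` and
`ℛ' = 𝒫'/𝒥'` with `𝒥' = I_1(XV) + ({det X(Ā) + ∇_{Ā,A} 𝔟 det V(A)})`, the minimal free
resolution of `ℛ'` over `𝒫'` has betti numbers `1, 10, 19, 19, 10, 1`: we assert the
existence of a free resolution with these ranks which is minimal, i.e. all entries of all the
differentials lie in the irrelevant maximal ideal (the ideal generated by the variables). -/

noncomputable section

/-- The variables `𝔟`, `v_{jk}` (`j : Fin 4`, `k : Fin 2`), `x_{ij}` (`i : Fin 2`,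
`j : Fin 4`). -/
abbrev sig17 : Type := Unit ⊕ (Fin 4 × Fin 2) ⊕ (Fin 2 × Fin 4)

abbrev P17 (K : Type*) [Field K] := MvPolynomial sig17 K

def V17 (K : Type*) [Field K] : Matrix (Fin 4) (Fin 2) (P17 K) := fun j k =>
  MvPolynomial.X (Sum.inr (Sum.inl (j, k)))

def X17 (K : Type*) [Field K] : Matrix (Fin 2) (Fin 4) (P17 K) := fun i j =>
  MvPolynomial.X (Sum.inr (Sum.inr (i, j)))

def b17 (K : Type*) [Field K] : P17 K := MvPolynomial.X (Sum.inl ())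

/-- The sign `∇_{Ā,A}`. -/
def nabla17 (K : Type*) [Field K] (A : Finset (Fin 4)) : P17 K :=
  (-1 : P17 K) ^
    ((Finset.univ.filter (fun p : Fin 4 × Fin 4 => p.1 ∈ A ∧ p.2 ∉ A ∧ p.1 < p.2)).card)

/-- The defining ideal `𝒥' = I_1(XV) + ({det X(Ā) + ∇_{Ā,A} 𝔟 det V(A)})`. -/
def J17 (K : Type*) [Field K] : Ideal (P17 K) :=
  Ideal.span {r : P17 K | ∃ i k, r = (X17 K * V17 K) i k} +
    Ideal.span {r : P17 K | ∃ (A : Finset (Fin 4)) (hA : A.card = 2),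
      r = ((X17 K).submatrix id
            (fun t : Fin 2 =>
              ((Aᶜ.orderIsoOfFin
                (by rw [Finset.card_compl, hA, Fintype.card_fin]) ) t : Fin 4))).det +
          nabla17 K A * b17 K *
            ((V17 K).submatrix (fun t : Fin 2 => ((A.orderIsoOfFin hA) t : Fin 4)) id).det}

/-- The betti numbers `1, 10, 19, 19, 10, 1`. -/
def r17 : ℕ → ℕ := fun i => [1, 10, 19, 19, 10, 1].getD i 0

abbrev Trm : Type := ℕ × ℤ × List ℕ

def cD0 : List (List Trm) :=
  [[(0,1,[1,9]),(0,1,[3,10]),(0,1,[5,11]),(0,1,[7,12])],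
   [(0,1,[2,9]),(0,1,[4,10]),(0,1,[6,11]),(0,1,[8,12])],
   [(0,1,[1,13]),(0,1,[3,14]),(0,1,[5,15]),(0,1,[7,16])],
   [(0,1,[2,13]),(0,1,[4,14]),(0,1,[6,15]),(0,1,[8,16])],
   [(0,1,[11,16]),(0,-1,[12,15]),(0,1,[0,1,4]),(0,-1,[0,2,3])],
   [(0,1,[10,16]),(0,-1,[12,14]),(0,-1,[0,1,6]),(0,1,[0,2,5])],
   [(0,1,[10,15]),(0,-1,[11,14]),(0,1,[0,1,8]),(0,-1,[0,2,7])],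
   [(0,1,[9,16]),(0,-1,[12,13]),(0,1,[0,3,6]),(0,-1,[0,4,5])],
   [(0,1,[9,15]),(0,-1,[11,13]),(0,-1,[0,3,8]),(0,1,[0,4,7])],
   [(0,1,[9,14]),(0,-1,[10,13]),(0,1,[0,5,8]),(0,-1,[0,6,7])]]

def cD1 : List (List Trm) :=
  [[(1,-1,[13]),(3,1,[9]),(7,-1,[8]),(8,-1,[6]),(9,-1,[4])],
   [(0,-1,[13]),(2,1,[9]),(7,-1,[7]),(8,-1,[5]),(9,-1,[3])],
   [(1,-1,[14]),(3,1,[10]),(5,-1,[8]),(6,-1,[6]),(9,1,[2])],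
   [(0,-1,[14]),(2,1,[10]),(5,-1,[7]),(6,-1,[5]),(9,1,[1])],
   [(1,-1,[15]),(3,1,[11]),(4,-1,[8]),(6,1,[4]),(8,1,[2])],
   [(0,-1,[15]),(2,1,[11]),(4,-1,[7]),(6,1,[3]),(8,1,[1])],
   [(1,-1,[16]),(3,1,[12]),(4,1,[6]),(5,1,[4]),(7,1,[2])],
   [(0,-1,[16]),(2,1,[12]),(4,1,[5]),(5,1,[3]),(7,1,[1])],
   [(2,-1,[8,16]),(2,-1,[6,15]),(2,-1,[4,14]),(2,-1,[2,13]),(3,1,[7,16]),(3,1,[5,15]),(3,1,[3,14]),(3,1,[1,13])],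
   [(0,-1,[8,16]),(0,-1,[6,15]),(0,-1,[4,14]),(0,-1,[2,13]),(3,1,[7,12]),(3,1,[5,11]),(3,1,[3,10]),(3,1,[1,9])],
   [(2,-1,[0,8]),(3,1,[0,7]),(6,1,[13]),(8,-1,[14]),(9,1,[15])],
   [(2,1,[0,6]),(3,-1,[0,5]),(5,1,[13]),(7,-1,[14]),(9,1,[16])],
   [(2,-1,[0,4]),(3,1,[0,3]),(4,1,[13]),(7,-1,[15]),(8,1,[16])],
   [(2,-1,[0,2]),(3,1,[0,1]),(4,-1,[14]),(5,1,[15]),(6,-1,[16])],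
   [(0,-1,[8,12]),(0,-1,[6,11]),(0,-1,[4,10]),(0,-1,[2,9]),(1,1,[7,12]),(1,1,[5,11]),(1,1,[3,10]),(1,1,[1,9])],
   [(0,-1,[0,8]),(1,1,[0,7]),(6,1,[9]),(8,-1,[10]),(9,1,[11])],
   [(0,1,[0,6]),(1,-1,[0,5]),(5,1,[9]),(7,-1,[10]),(9,1,[12])],
   [(0,-1,[0,4]),(1,1,[0,3]),(4,1,[9]),(7,-1,[11]),(8,1,[12])],
   [(0,-1,[0,2]),(1,1,[0,1]),(4,-1,[10]),(5,1,[11]),(6,-1,[12])]]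

def cD2 : List (List Trm) :=
  [[(0,-1,[7,16]),(0,-1,[5,15]),(0,-1,[3,14]),(1,1,[8,16]),(1,1,[6,15]),(1,1,[4,14]),(1,1,[2,13]),(2,1,[3,13]),(4,1,[5,13]),(6,1,[7,13]),(8,1,[9]),(9,-1,[13]),(10,-1,[4,5]),(10,1,[3,6]),(11,-1,[4,7]),(11,1,[3,8]),(12,-1,[6,7]),(12,1,[5,8])],
   [(0,1,[1,14]),(2,-1,[7,16]),(2,-1,[5,15]),(2,-1,[1,13]),(3,1,[8,16]),(3,1,[6,15]),(3,1,[4,14]),(3,1,[2,13]),(4,1,[5,14]),(6,1,[7,14]),(8,1,[10]),(9,-1,[14]),(10,1,[2,5]),(10,-1,[1,6]),(11,1,[2,7]),(11,-1,[1,8]),(13,1,[6,7]),(13,-1,[5,8])],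
   [(0,-1,[1,15]),(2,-1,[3,15]),(4,1,[7,16]),(4,1,[3,14]),(4,1,[1,13]),(5,-1,[8,16]),(5,-1,[6,15]),(5,-1,[4,14]),(5,-1,[2,13]),(6,-1,[7,15]),(8,-1,[11]),(9,1,[15]),(10,1,[2,3]),(10,-1,[1,4]),(12,-1,[2,7]),(12,1,[1,8]),(13,1,[4,7]),(13,-1,[3,8])],
   [(0,-1,[1,16]),(2,-1,[3,16]),(4,-1,[5,16]),(6,1,[5,15]),(6,1,[3,14]),(6,1,[1,13]),(7,-1,[8,16]),(7,-1,[6,15]),(7,-1,[4,14]),(7,-1,[2,13]),(8,-1,[12]),(9,1,[16]),(11,1,[2,3]),(11,-1,[1,4]),(12,1,[2,5]),(12,-1,[1,6]),(13,-1,[4,5]),(13,1,[3,6])],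
   [(8,-1,[0]),(10,1,[16]),(11,-1,[15]),(12,1,[14]),(13,1,[13])],
   [(0,1,[7,12]),(0,1,[5,11]),(0,1,[3,10]),(0,1,[1,9]),(1,-1,[8,12]),(1,-1,[6,11]),(1,-1,[4,10]),(3,1,[4,9]),(5,1,[6,9]),(7,1,[8,9]),(9,-1,[9]),(14,1,[13]),(15,1,[4,5]),(15,-1,[3,6]),(16,1,[4,7]),(16,-1,[3,8]),(17,1,[6,7]),(17,-1,[5,8])],
   [(1,-1,[2,10]),(2,-1,[7,12]),(2,-1,[5,11]),(2,-1,[3,10]),(2,-1,[1,9]),(3,1,[8,12]),(3,1,[6,11]),(3,1,[2,9]),(5,-1,[6,10]),(7,-1,[8,10]),(9,1,[10]),(14,-1,[14]),(15,1,[2,5]),(15,-1,[1,6]),(16,1,[2,7]),(16,-1,[1,8]),(18,1,[6,7]),(18,-1,[5,8])],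
   [(1,-1,[2,11]),(3,-1,[4,11]),(4,-1,[7,12]),(4,-1,[5,11]),(4,-1,[3,10]),(4,-1,[1,9]),(5,1,[8,12]),(5,1,[4,10]),(5,1,[2,9]),(7,-1,[8,11]),(9,1,[11]),(14,-1,[15]),(15,-1,[2,3]),(15,1,[1,4]),(17,1,[2,7]),(17,-1,[1,8]),(18,-1,[4,7]),(18,1,[3,8])],
   [(1,-1,[2,12]),(3,-1,[4,12]),(5,-1,[6,12]),(6,-1,[7,12]),(6,-1,[5,11]),(6,-1,[3,10]),(6,-1,[1,9]),(7,1,[6,11]),(7,1,[4,10]),(7,1,[2,9]),(9,1,[12]),(14,-1,[16]),(16,-1,[2,3]),(16,1,[1,4]),(17,-1,[2,5]),(17,1,[1,6]),(18,1,[4,5]),(18,-1,[3,6])],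
   [(0,1,[0,1]),(1,1,[0,2]),(2,1,[0,3]),(3,1,[0,4]),(4,1,[0,5]),(5,1,[0,6]),(6,1,[0,7]),(7,1,[0,8]),(9,-2,[0]),(10,1,[12]),(11,-1,[11]),(12,1,[10]),(13,1,[9]),(15,1,[16]),(16,-1,[15]),(17,1,[14]),(18,1,[13])],
   [(14,-1,[0]),(15,1,[12]),(16,-1,[11]),(17,1,[10]),(18,1,[9])],
   [(0,-1,[11,14]),(0,1,[10,15]),(0,-1,[0,2,7]),(2,1,[11,13]),(2,-1,[9,15]),(2,-1,[0,4,7]),(4,-1,[10,13]),(4,1,[9,14]),(4,-1,[0,6,7]),(6,-1,[0,7,8]),(9,1,[0,8]),(10,1,[6,11]),(10,1,[4,10]),(10,1,[2,9]),(11,1,[8,11]),(12,-1,[8,10]),(13,-1,[8,9]),(15,-1,[8,16]),(15,-1,[6,15]),(15,-1,[4,14]),(15,-1,[2,13])],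
   [(1,-1,[11,14]),(1,1,[10,15]),(1,1,[0,1,8]),(3,1,[11,13]),(3,-1,[9,15]),(3,1,[0,3,8]),(5,-1,[10,13]),(5,1,[9,14]),(5,1,[0,5,8]),(7,1,[0,7,8]),(9,-1,[0,7]),(10,1,[7,12]),(10,1,[5,11]),(10,1,[3,10]),(10,1,[1,9]),(15,-1,[5,15]),(15,-1,[3,14]),(15,-1,[1,13]),(16,-1,[7,15]),(17,1,[7,14]),(18,1,[7,13])],
   [(0,-1,[12,14]),(0,1,[10,16]),(0,1,[0,2,5]),(2,1,[12,13]),(2,-1,[9,16]),(2,1,[0,4,5]),(4,1,[0,5,6]),(6,-1,[10,13]),(6,1,[9,14]),(6,1,[0,5,8]),(9,-1,[0,6]),(10,1,[6,12]),(11,1,[8,12]),(11,1,[4,10]),(11,1,[2,9]),(12,1,[6,10]),(13,1,[6,9]),(16,-1,[8,16]),(16,-1,[6,15]),(16,-1,[4,14]),(16,-1,[2,13])],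
   [(1,1,[12,14]),(1,-1,[10,16]),(1,1,[0,1,6]),(3,-1,[12,13]),(3,1,[9,16]),(3,1,[0,3,6]),(5,1,[0,5,6]),(7,1,[10,13]),(7,-1,[9,14]),(7,1,[0,6,7]),(9,-1,[0,5]),(11,-1,[7,12]),(11,-1,[5,11]),(11,-1,[3,10]),(11,-1,[1,9]),(15,1,[5,16]),(16,1,[7,16]),(16,1,[3,14]),(16,1,[1,13]),(17,1,[5,14]),(18,1,[5,13])],
   [(0,-1,[12,15]),(0,1,[11,16]),(0,-1,[0,2,3]),(2,-1,[0,3,4]),(4,1,[12,13]),(4,-1,[9,16]),(4,-1,[0,3,6]),(6,-1,[11,13]),(6,1,[9,15]),(6,-1,[0,3,8]),(9,1,[0,4]),(10,-1,[4,12]),(11,1,[4,11]),(12,1,[8,12]),(12,1,[6,11]),(12,1,[2,9]),(13,-1,[4,9]),(17,-1,[8,16]),(17,-1,[6,15]),(17,-1,[4,14]),(17,-1,[2,13])],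
   [(1,1,[12,15]),(1,-1,[11,16]),(1,-1,[0,1,4]),(3,-1,[0,3,4]),(5,-1,[12,13]),(5,1,[9,16]),(5,-1,[0,4,5]),(7,1,[11,13]),(7,-1,[9,15]),(7,-1,[0,4,7]),(9,1,[0,3]),(12,-1,[7,12]),(12,-1,[5,11]),(12,-1,[3,10]),(12,-1,[1,9]),(15,-1,[3,16]),(16,1,[3,15]),(17,1,[7,16]),(17,1,[5,15]),(17,1,[1,13]),(18,-1,[3,13])],
   [(0,-1,[0,1,2]),(2,1,[12,15]),(2,-1,[11,16]),(2,-1,[0,1,4]),(4,-1,[12,14]),(4,1,[10,16]),(4,-1,[0,1,6]),(6,1,[11,14]),(6,-1,[10,15]),(6,-1,[0,1,8]),(9,1,[0,2]),(10,-1,[2,12]),(11,1,[2,11]),(12,-1,[2,10]),(13,1,[8,12]),(13,1,[6,11]),(13,1,[4,10]),(18,-1,[8,16]),(18,-1,[6,15]),(18,-1,[4,14]),(18,-1,[2,13])],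
   [(1,1,[0,1,2]),(3,1,[12,15]),(3,-1,[11,16]),(3,1,[0,2,3]),(5,-1,[12,14]),(5,1,[10,16]),(5,1,[0,2,5]),(7,1,[11,14]),(7,-1,[10,15]),(7,1,[0,2,7]),(9,-1,[0,1]),(13,1,[7,12]),(13,1,[5,11]),(13,1,[3,10]),(13,1,[1,9]),(15,1,[1,16]),(16,-1,[1,15]),(17,1,[1,14]),(18,-1,[7,16]),(18,-1,[5,15]),(18,-1,[3,14])]]

def cD3 : List (List Trm) :=
  [[(0,1,[10]),(1,-1,[9]),(5,1,[14]),(6,1,[13]),(11,1,[5]),(12,-1,[6]),(13,1,[7]),(14,1,[8])],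
   [(0,1,[11]),(2,1,[9]),(5,1,[15]),(7,1,[13]),(11,-1,[3]),(12,1,[4]),(15,1,[7]),(16,1,[8])],
   [(0,1,[12]),(3,1,[9]),(5,1,[16]),(8,1,[13]),(13,-1,[3]),(14,-1,[4]),(15,-1,[5]),(16,-1,[6])],
   [(1,1,[11]),(2,1,[10]),(6,-1,[15]),(7,1,[14]),(11,1,[1]),(12,-1,[2]),(17,-1,[7]),(18,1,[8])],
   [(1,1,[12]),(3,1,[10]),(6,-1,[16]),(8,1,[14]),(13,1,[1]),(14,1,[2]),(17,1,[5]),(18,-1,[6])],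
   [(2,-1,[12]),(3,1,[11]),(7,-1,[16]),(8,1,[15]),(15,1,[1]),(16,1,[2]),(17,-1,[3]),(18,1,[4])],
   [(0,-1,[0,2]),(1,-1,[0,4]),(2,1,[0,6]),(3,1,[0,8]),(4,-1,[8,12]),(4,-1,[6,11]),(4,-1,[4,10]),(4,-1,[2,9]),(9,1,[8,16]),(9,1,[6,15]),(9,1,[4,14]),(9,1,[2,13]),(11,1,[16]),(13,-1,[15]),(15,1,[14]),(17,1,[13])],
   [(0,-1,[0,1]),(1,-1,[0,3]),(2,1,[0,5]),(3,1,[0,7]),(4,-1,[7,12]),(4,-1,[5,11]),(4,-1,[3,10]),(4,-1,[1,9]),(12,1,[16]),(14,1,[15]),(16,-1,[14]),(18,1,[13])],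
   [(5,1,[0,2]),(6,-1,[0,4]),(7,-1,[0,6]),(8,-1,[0,8]),(10,1,[8,16]),(10,1,[6,15]),(10,1,[4,14]),(10,1,[2,13]),(11,1,[12]),(13,-1,[11]),(15,1,[10]),(17,1,[9])],
   [(5,-1,[0,1]),(6,1,[0,3]),(7,1,[0,5]),(8,1,[0,7]),(9,1,[7,12]),(9,1,[5,11]),(9,1,[3,10]),(9,1,[1,9]),(10,-1,[7,16]),(10,-1,[5,15]),(10,-1,[3,14]),(10,-1,[1,13]),(12,-1,[12]),(14,-1,[11]),(16,1,[10]),(18,-1,[9])]]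

def cD4 : List (List Trm) :=
  [[(0,1,[12,15]),(0,-1,[11,16]),(0,1,[0,2,3]),(0,-1,[0,1,4]),(1,-1,[12,14]),(1,1,[10,16]),(1,1,[0,2,5]),(1,-1,[0,1,6]),(2,1,[11,14]),(2,-1,[10,15]),(2,1,[0,2,7]),(2,-1,[0,1,8]),(3,1,[12,13]),(3,-1,[9,16]),(3,1,[0,4,5]),(3,-1,[0,3,6]),(4,-1,[11,13]),(4,1,[9,15]),(4,1,[0,4,7]),(4,-1,[0,3,8]),(5,1,[10,13]),(5,-1,[9,14]),(5,1,[0,6,7]),(5,-1,[0,5,8]),(6,1,[7,12]),(6,1,[5,11]),(6,1,[3,10]),(6,1,[1,9]),(7,-1,[8,12]),(7,-1,[6,11]),(7,-1,[4,10]),(7,-1,[2,9]),(8,-1,[7,16]),(8,-1,[5,15]),(8,-1,[3,14]),(8,-1,[1,13]),(9,-1,[8,16]),(9,-1,[6,15]),(9,-1,[4,14]),(9,-1,[2,13])]]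

def cD : ℕ → List (List Trm)
  | 0 => cD0
  | 1 => cD1
  | 2 => cD2
  | 3 => cD3
  | 4 => cD4
  | _ => []

def cH00 : List (List Trm) :=
  [[(0,1,[])]]

def cH01 : List (List Trm) :=
  [[],
   [(14,1,[])],
   [(1,1,[1]),(3,1,[3]),(5,1,[5]),(7,1,[7])],
   [(9,1,[])],
   [(5,-1,[12]),(7,1,[11]),(17,1,[1]),(18,-1,[3])],
   [(3,-1,[12]),(7,1,[10]),(16,1,[1]),(18,1,[5])],
   [(3,-1,[11]),(5,1,[10]),(15,1,[1]),(18,-1,[7])],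
   [(1,-1,[12]),(7,1,[9]),(16,-1,[3]),(17,-1,[5])],
   [(1,-1,[11]),(5,1,[9]),(15,-1,[3]),(17,1,[7])],
   [(1,-1,[10]),(3,1,[9]),(15,1,[5]),(16,1,[7])]]

def cH02 : List (List Trm) :=
  [[(5,1,[])],
   [],
   [(6,-1,[])],
   [],
   [(7,-1,[])],
   [],
   [(8,-1,[])],
   [],
   [(0,1,[1]),(1,1,[3]),(2,-1,[5]),(3,-1,[7])],
   [],
   [(12,1,[])],
   [(14,-1,[])],
   [(16,-1,[])],
   [(18,1,[])],
   [],
   [(10,1,[7])],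
   [(10,-1,[5])],
   [(10,1,[3])],
   [(10,1,[1])]]

def cH03 : List (List Trm) :=
  [[(0,1,[3]),(1,1,[5]),(2,1,[7])],
   [(0,-1,[1]),(3,1,[5]),(4,1,[7])],
   [(1,1,[1]),(3,1,[3]),(5,-1,[7])],
   [(2,1,[1]),(4,1,[3]),(5,1,[5])],
   [(7,-1,[])],
   [],
   [],
   [],
   [],
   [(9,1,[])],
   [],
   [(0,1,[11]),(1,-1,[10]),(3,1,[9]),(8,1,[7])],
   [],
   [(0,1,[12]),(2,-1,[10]),(4,1,[9]),(8,-1,[5])],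
   [],
   [(1,1,[12]),(2,-1,[11]),(5,1,[9]),(8,1,[3])],
   [],
   [(3,-1,[12]),(4,1,[11]),(5,-1,[10]),(8,1,[1])],
   []]

def cH04 : List (List Trm) :=
  [[],
   [],
   [],
   [],
   [],
   [],
   [(0,1,[])],
   [],
   [],
   []]

def cH11 : List (List Trm) :=
  [[(9,-1,[])],
   [(0,-1,[2]),(2,-1,[4]),(4,-1,[6]),(6,-1,[8])],
   [(8,-1,[])],
   [],
   [(4,-1,[16]),(6,1,[15]),(12,1,[2]),(13,-1,[4])],
   [(2,-1,[16]),(6,1,[14]),(11,1,[2]),(13,1,[6])],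
   [(2,-1,[15]),(4,1,[14]),(10,1,[2]),(13,-1,[8])],
   [(0,-1,[16]),(6,1,[13]),(11,-1,[4]),(12,-1,[6])],
   [(0,-1,[15]),(4,1,[13]),(10,-1,[4]),(12,1,[8])],
   [(0,-1,[14]),(2,1,[13]),(10,1,[6]),(11,1,[8])]]

def cH12 : List (List Trm) :=
  [[],
   [(0,1,[])],
   [],
   [(1,1,[])],
   [],
   [(2,-1,[])],
   [],
   [(3,-1,[])],
   [],
   [],
   [(4,1,[8])],
   [(4,-1,[6])],
   [(4,1,[4])],
   [(4,1,[2])],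
   [(5,1,[2]),(6,-1,[4]),(7,-1,[6]),(8,-1,[8])],
   [(11,-1,[])],
   [(13,-1,[])],
   [(15,-1,[])],
   [(17,-1,[])]]

def cH13 : List (List Trm) :=
  [[],
   [],
   [],
   [],
   [],
   [(0,1,[4]),(1,1,[6]),(2,1,[8])],
   [(0,1,[2]),(3,-1,[6]),(4,-1,[8])],
   [(1,1,[2]),(3,1,[4]),(5,-1,[8])],
   [(2,1,[2]),(4,1,[4]),(5,1,[6])],
   [(6,1,[])],
   [(8,1,[])],
   [],
   [(0,-1,[15]),(1,1,[14]),(3,-1,[13]),(7,1,[8])],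
   [],
   [(0,1,[16]),(2,-1,[14]),(4,1,[13]),(7,1,[6])],
   [],
   [(1,1,[16]),(2,-1,[15]),(5,1,[13]),(7,-1,[4])],
   [],
   [(3,1,[16]),(4,-1,[15]),(5,1,[14]),(7,1,[2])]]

def cH14 : List (List Trm) :=
  [[],
   [],
   [],
   [],
   [],
   [],
   [],
   [],
   [],
   [(0,-1,[])]]

def cH22 : List (List Trm) :=
  [[],
   [(5,-1,[])],
   [],
   [(6,1,[])],
   [],
   [(7,1,[])],
   [],
   [(8,1,[])],
   [(0,1,[2]),(1,1,[4]),(2,-1,[6]),(3,-1,[8])],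
   [(5,-1,[2]),(6,1,[4]),(7,1,[6]),(8,1,[8])],
   [(9,1,[8]),(11,1,[])],
   [(9,-1,[6]),(13,1,[])],
   [(9,1,[4]),(15,1,[])],
   [(9,1,[2]),(17,1,[])],
   [],
   [(10,1,[8])],
   [(10,-1,[6])],
   [(10,1,[4])],
   [(10,1,[2])]]

def cH23 : List (List Trm) :=
  [[(0,1,[4]),(1,1,[6]),(2,1,[8])],
   [(0,-1,[2]),(3,1,[6]),(4,1,[8])],
   [(1,1,[2]),(3,1,[4]),(5,-1,[8])],
   [(2,1,[2]),(4,1,[4]),(5,1,[6])],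
   [(6,-1,[])],
   [],
   [],
   [],
   [],
   [(8,-1,[])],
   [],
   [(8,1,[8])],
   [(0,-1,[11]),(1,1,[10]),(3,-1,[9]),(8,-1,[7]),(9,-1,[8])],
   [(8,-1,[6])],
   [(0,1,[12]),(2,-1,[10]),(4,1,[9]),(8,-1,[5]),(9,-1,[6])],
   [(8,1,[4])],
   [(1,1,[12]),(2,-1,[11]),(5,1,[9]),(8,1,[3]),(9,1,[4])],
   [(8,1,[2])],
   [(3,1,[12]),(4,-1,[11]),(5,1,[10]),(8,-1,[1]),(9,-1,[2])]]

def cH24 : List (List Trm) :=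
  [[],
   [],
   [],
   [],
   [],
   [],
   [],
   [(0,-1,[])],
   [],
   []]

def cH33 : List (List Trm) :=
  [[],
   [],
   [],
   [],
   [],
   [(0,1,[3]),(1,1,[5]),(2,1,[7])],
   [(0,1,[1]),(3,-1,[5]),(4,-1,[7])],
   [(1,1,[1]),(3,1,[3]),(5,-1,[7])],
   [(2,1,[1]),(4,1,[3]),(5,1,[5])],
   [(7,1,[])],
   [(9,-1,[])],
   [(0,1,[15]),(1,-1,[14]),(3,1,[13]),(6,1,[7]),(7,-1,[8])],
   [(7,1,[7])],
   [(0,1,[16]),(2,-1,[14]),(4,1,[13]),(6,-1,[5]),(7,1,[6])],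
   [(7,1,[5])],
   [(1,1,[16]),(2,-1,[15]),(5,1,[13]),(6,1,[3]),(7,-1,[4])],
   [(7,-1,[3])],
   [(3,-1,[16]),(4,1,[15]),(5,-1,[14]),(6,1,[1]),(7,-1,[2])],
   [(7,1,[1])]]

def cH34 : List (List Trm) :=
  [[],
   [],
   [],
   [],
   [],
   [],
   [],
   [],
   [(0,-1,[])],
   []]

def cH44 : List (List Trm) :=
  [[],
   [],
   [(0,-1,[])],
   [],
   [],
   [],
   [],
   [],
   [],
   []]

def cH : ℕ → ℕ → List (List Trm)
  | 0, 0 => cH00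
  | 0, 1 => cH01
  | 0, 2 => cH02
  | 0, 3 => cH03
  | 0, 4 => cH04
  | 1, 1 => cH11
  | 1, 2 => cH12
  | 1, 3 => cH13
  | 1, 4 => cH14
  | 2, 2 => cH22
  | 2, 3 => cH23
  | 2, 4 => cH24
  | 3, 3 => cH33
  | 3, 4 => cH34
  | 4, 4 => cH44
  | _, _ => []

def cF : ℕ → List Trm
  | 0 => [(0,1,[1,9]),(0,1,[3,10]),(0,1,[5,11]),(0,1,[7,12])]
  | 1 => [(0,1,[2,13]),(0,1,[4,14]),(0,1,[6,15]),(0,1,[8,16])]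
  | 2 => [(0,1,[2,9]),(0,1,[4,10]),(0,1,[6,11]),(0,1,[8,12])]
  | 3 => [(0,1,[1,13]),(0,1,[3,14]),(0,1,[5,15]),(0,1,[7,16])]
  | 4 => [(0,1,[10,15]),(0,-1,[11,14]),(0,1,[0,1,8]),(0,-1,[0,2,7])]
  | _ => []

/-! ### Computable sparse polynomial vectors -/

def insM (a : ℕ) : List ℕ → List ℕ
  | [] => [a]
  | b :: l => bif Nat.ble a b then a :: b :: l else b :: insM a l

def mulM (m n : List ℕ) : List ℕ := m.foldr insM n

def eqM : List ℕ → List ℕ → Bool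
  | [], [] => true
  | a :: l, b :: k => bif Nat.beq a b then eqM l k else false
  | _, _ => false

theorem eqM_eq : ∀ l k : List ℕ, eqM l k = true → l = k
  | [], [], _ => rfl
  | a :: l, b :: k, h => by
    unfold eqM at h
    cases hb : Nat.beq a b with
    | false => simp [hb] at h
    | true =>
      simp only [hb, cond_true] at h
      rw [Nat.eq_of_beq_eq_true hb, eqM_eq l k h]
  | [], _ :: _, h => by simp [eqM] at h
  | _ :: _, [], h => by simp [eqM] at h

def insT (t : Trm) : List Trm → List Trm
  | [] => [t]
  | s :: l => bif (bif Nat.beq t.1 s.1 then eqM t.2.2 s.2.2 else false) then (s.1, t.2.1 + s.2.1, s.2.2) :: l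
      else s :: insT t l

def isZ (l : List Trm) : Bool := (l.foldr insT []).all fun t => t.2.1 == 0

def sclT (t : Trm) (l : List Trm) : List Trm :=
  l.map fun s => (s.1, t.2.1 * s.2.1, mulM t.2.2 s.2.2)

def cmpT (A : List (List Trm)) : List Trm → List Trm
  | [] => []
  | t :: l => sclT t (A.getD t.1 []) ++ cmpT A l

def bndT (n : ℕ) (l : List Trm) : Bool := l.all fun t => Nat.blt t.1 n

def chkDD (i : ℕ) : Bool :=
  (cD (i + 1)).all fun l => isZ (cmpT (cD i) l) && bndT (r17 (i + 1)) l

def chkH (m j : ℕ) : Bool :=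
  (List.range (r17 (j + 1))).all fun e =>
    isZ (cmpT (cD (j + 1)) ((cH m (j + 1)).getD e []) ++
      (cmpT (cH m j) ((cD j).getD e []) ++ sclT (0, -1, []) ((cF m).map fun s => (e, s.2)))) &&
    (bndT (r17 (j + 2)) ((cH m (j + 1)).getD e []) && bndT (r17 j) ((cD j).getD e []))

theorem chkDD_ok : ((List.range 4).all chkDD) = true := by decide +kernel

theorem chkH_ok : ((List.range 5).all fun j => (List.range (j + 1)).all fun m => chkH m j) = true := by
  decide +kernel

theorem chk_min : ((List.range 5).all fun i => (cD i).all fun l => l.all fun t => !t.2.2.isEmpty)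
    = true := by decide +kernel

section sem
variable {R : Type*} [CommRing R] (ρ : ℕ → R)

def evM (m : List ℕ) : R := (m.map ρ).prod

def evT (l : List Trm) (a : ℕ) : R :=
  (l.map fun t => if t.1 = a then (t.2.1 : R) * evM ρ t.2.2 else 0).sum

theorem evM_insM (a : ℕ) (l : List ℕ) : evM ρ (insM a l) = ρ a * evM ρ l := by
  induction l with
  | nil => simp [insM, evM]
  | cons b l ih =>
    unfold insM
    rw [Bool.cond_eq_ite]
    split_ifs
    · simp [evM]
    · simp only [evM, List.map_cons, List.prod_cons] at ih ⊢
      rw [ih]; ring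

theorem evM_mulM (m n : List ℕ) : evM ρ (mulM m n) = evM ρ m * evM ρ n := by
  induction m with
  | nil => simp [mulM, evM]
  | cons b l ih =>
    have : mulM (b :: l) n = insM b (mulM l n) := rfl
    rw [this, evM_insM, ih]
    simp [evM, mul_assoc]

theorem evT_cons (t : Trm) (l : List Trm) (a : ℕ) :
    evT ρ (t :: l) a = (if t.1 = a then (t.2.1 : R) * evM ρ t.2.2 else 0) + evT ρ l a := by
  simp [evT]

theorem evT_nil (a : ℕ) : evT ρ [] a = 0 := by simp [evT]

theorem evT_append (l l' : List Trm) (a : ℕ) :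
    evT ρ (l ++ l') a = evT ρ l a + evT ρ l' a := by
  simp [evT]

theorem evT_insT (t : Trm) (l : List Trm) (a : ℕ) :
    evT ρ (insT t l) a = evT ρ (t :: l) a := by
  induction l with
  | nil => simp [insT]
  | cons s l ih =>
    unfold insT
    rw [Bool.cond_eq_ite]
    split_ifs with h
    · rw [Bool.cond_eq_ite] at h
      split_ifs at h with h0
      have h1 : t.1 = s.1 := Nat.eq_of_beq_eq_true h0
      have h2 := eqM_eq _ _ h
      simp only [evT_cons, h1, h2]
      split_ifs
      · push_cast; ring
      · simp
    · simp only [evT_cons] at ih ⊢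
      rw [ih]; ring

theorem evT_isZ (l : List Trm) (h : isZ l = true) (a : ℕ) : evT ρ l a = 0 := by
  have h1 : evT ρ (l.foldr insT []) a = evT ρ l a := by
    clear h
    induction l with
    | nil => rfl
    | cons t l ih => rw [List.foldr_cons, evT_insT, evT_cons, ih, ← evT_cons]
  rw [← h1]
  unfold isZ at h
  generalize l.foldr insT [] = k at h
  induction k with
  | nil => simp [evT]
  | cons t k ih =>
    simp only [List.all_cons, Bool.and_eq_true, beq_iff_eq] at h
    rw [evT_cons, ih h.2, h.1]
    simp

theorem evT_sclT (t : Trm) (l : List Trm) (a : ℕ) :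
    evT ρ (sclT t l) a = (t.2.1 : R) * evM ρ t.2.2 * evT ρ l a := by
  induction l with
  | nil => simp [sclT, evT]
  | cons s l ih =>
    have : sclT t (s :: l) = (s.1, t.2.1 * s.2.1, mulM t.2.2 s.2.2) :: sclT t l := rfl
    rw [this, evT_cons, ih, evT_cons]
    split_ifs
    · simp only [evM_mulM]; push_cast; ring
    · ring

/-- entry of the matrix -/
def ent (A : List (List Trm)) (a c : ℕ) : R := evT ρ (A.getD c []) a

theorem evT_cmpT (A : List (List Trm)) (n : ℕ) (l : List Trm) (hl : bndT n l = true) (a : ℕ) :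
    evT ρ (cmpT A l) a = ∑ r : Fin n, ent ρ A a r * evT ρ l r := by
  induction l with
  | nil => simp [cmpT, evT]
  | cons t l ih =>
    unfold bndT at hl ih
    simp only [List.all_cons, Bool.and_eq_true] at hl
    have ht : t.1 < n := by simpa [Nat.blt] using hl.1
    have : cmpT A (t :: l) = sclT t (A.getD t.1 []) ++ cmpT A l := rfl
    rw [this, evT_append, evT_sclT, ih hl.2]
    simp only [evT_cons, mul_add, Finset.sum_add_distrib]
    congr 1
    rw [Finset.sum_eq_single (⟨t.1, ht⟩ : Fin n)]
    · simp [ent]; ring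
    · intro b _ hb
      rw [if_neg, mul_zero]
      intro h
      exact hb (Fin.ext h.symm)
    · simp

theorem evT_reidx (l : List Trm) (e a : ℕ) :
    evT ρ (l.map fun s => (e, s.2)) a
      = if e = a then (l.map fun s => (s.2.1 : R) * evM ρ s.2.2).sum else 0 := by
  induction l with
  | nil => simp [evT]
  | cons s l ih =>
    rw [List.map_cons, evT_cons, ih]
    split_ifs <;> simp

def MD (i : ℕ) : Matrix (Fin (r17 i)) (Fin (r17 (i + 1))) R := fun a c => ent ρ (cD i) a c
def MH (m j : ℕ) : Matrix (Fin (r17 (j + 1))) (Fin (r17 j)) R := fun a c => ent ρ (cH m j) a c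
def fF (m : ℕ) : R := ((cF m).map fun s => (s.2.1 : R) * evM ρ s.2.2).sum

theorem r17_big (i : ℕ) (hi : 6 ≤ i) : r17 i = 0 := by
  unfold r17
  rw [List.getD_eq_default]
  simpa using hi

theorem MD_mul (i : ℕ) : (MD ρ i) * (MD ρ (i + 1)) = 0 := by
  ext a c
  by_cases hi : i < 4
  · have h := List.all_eq_true.1 chkDD_ok i (List.mem_range.2 hi)
    unfold chkDD at h
    rw [Matrix.mul_apply]
    change ∑ r : Fin (r17 (i + 1)), ent ρ (cD i) a r * evT ρ ((cD (i + 1)).getD c []) r = 0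
    by_cases hc : (c : ℕ) < (cD (i + 1)).length
    · have h2 := List.all_eq_true.1 h ((cD (i + 1)).getD c []) (by
        rw [List.getD_eq_getElem _ _ hc]; exact List.getElem_mem hc)
      rw [Bool.and_eq_true] at h2
      rw [← evT_cmpT ρ _ _ _ h2.2, evT_isZ ρ _ h2.1]
    · rw [List.getD_eq_default _ _ (not_lt.1 hc)]
      simp [evT]
  · have := r17_big (i + 1 + 1) (by omega)
    exact absurd c.2 (by omega)

theorem MH_mul (m j : ℕ) (hmj : m ≤ j) :
    MD ρ (j + 1) * MH ρ m (j + 1) + MH ρ m j * MD ρ j = fF ρ m • 1 := by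
  ext a c
  by_cases hj : j < 5
  · have h := List.all_eq_true.1 chkH_ok j (List.mem_range.2 hj)
    have h := List.all_eq_true.1 h m (List.mem_range.2 (by omega))
    have h := List.all_eq_true.1 h c (List.mem_range.2 c.2)
    rw [Bool.and_eq_true, Bool.and_eq_true] at h
    obtain ⟨h0, h1, h2⟩ := h
    have h0 := evT_isZ ρ _ h0 a
    rw [evT_append, evT_append, evT_cmpT ρ _ _ _ h1, evT_cmpT ρ _ _ _ h2, evT_sclT,
      evT_reidx] at h0
    rw [Matrix.add_apply, Matrix.mul_apply, Matrix.mul_apply, Matrix.smul_apply]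
    change (∑ r : Fin (r17 (j + 2)), ent ρ (cD (j + 1)) a r * evT ρ ((cH m (j + 1)).getD c []) r) +
      (∑ r : Fin (r17 j), ent ρ (cH m j) a r * evT ρ ((cD j).getD c []) r) = _
    have e : (if (c : ℕ) = (a : ℕ) then fF ρ m else 0) =
        fF ρ m • (1 : Matrix (Fin (r17 (j + 1))) (Fin (r17 (j + 1))) R) a c := by
      by_cases hac : a = c
      · subst hac; simp
      · rw [if_neg (fun h => hac (Fin.ext h.symm)), Matrix.one_apply_ne hac]; simp
    rw [← e]
    have h3 : ((-1 : ℤ) : R) * evM ρ [] = -1 := by simp [evM]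
    change _ + (_ + ((-1 : ℤ) : R) * evM ρ [] * (if (c : ℕ) = (a : ℕ) then fF ρ m else 0)) = 0
      at h0
    rw [h3] at h0
    linear_combination h0
  · have := r17_big (j + 1) (by omega)
    exact absurd c.2 (by omega)

/-- acyclicity -/
theorem chain (reg : ∀ m < 5, ∀ g : R,
      fF ρ m * g ∈ Ideal.span ((fF ρ) '' {i | i < m}) → g ∈ Ideal.span ((fF ρ) '' {i | i < m}))
    (n : ℕ) : ∀ m j : ℕ, 5 ≤ j + n → m ≤ j → ∀ z : Fin (r17 (j + 1)) → R,
      (∀ a, (MD ρ j).mulVec z a ∈ Ideal.span ((fF ρ) '' {i | i < m})) →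
      ∃ w, ∀ a, (z - (MD ρ (j + 1)).mulVec w) a ∈ Ideal.span ((fF ρ) '' {i | i < m}) := by
  have mv : ∀ (I : Ideal R) {p q : ℕ} (A : Matrix (Fin p) (Fin q) R) (z : Fin q → R),
      (∀ a, z a ∈ I) → ∀ a, A.mulVec z a ∈ I := by
    intro I p q A z hz a
    rw [Matrix.mulVec, dotProduct]
    exact Ideal.sum_mem _ fun i _ => Ideal.mul_mem_left _ _ (hz i)
  have triv : ∀ m j : ℕ, 5 ≤ j → ∀ z : Fin (r17 (j + 1)) → R,
      ∃ w, ∀ a, (z - (MD ρ (j + 1)).mulVec w) a ∈ Ideal.span ((fF ρ) '' {i | i < m}) := by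
    intro m j hj z
    refine ⟨0, fun a => ?_⟩
    have := r17_big (j + 1) (by omega)
    exact absurd a.2 (by omega)
  induction n with
  | zero => intro m j hj _ z _; exact triv m j hj z
  | succ n ih =>
    intro m j hj hm z hz
    by_cases hj5 : 5 ≤ j
    · exact triv m j hj5 z
    set I := Ideal.span ((fF ρ) '' {i | i < m}) with hI
    have hI1 : ∀ y, y ∈ Ideal.span ((fF ρ) '' {i | i < m + 1}) ↔ ∃ u, y - fF ρ m * u ∈ I := by
      intro y
      have : {i | i < m + 1} = insert m {i | i < m} := by ext i; simp; omega
      rw [this, Set.image_insert_eq, Ideal.mem_span_insert]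
      constructor
      · rintro ⟨u, t, ht, rfl⟩
        exact ⟨u, by convert ht using 1; ring⟩
      · rintro ⟨u, hu⟩
        exact ⟨u, _, hu, by ring⟩
    have key : (MD ρ (j + 1)).mulVec ((MH ρ m (j + 1)).mulVec z)
        + (MH ρ m j).mulVec ((MD ρ j).mulVec z) = fF ρ m • z := by
      rw [Matrix.mulVec_mulVec, Matrix.mulVec_mulVec, ← Matrix.add_mulVec, MH_mul ρ m j hm,
        Matrix.smul_mulVec, Matrix.one_mulVec]
    have h1 := mv I (MH ρ m j) _ hz
    obtain ⟨w, hw⟩ := ih (m + 1) (j + 1) (by omega) (by omega) ((MH ρ m (j + 1)).mulVec z) (by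
      intro a
      rw [hI1]
      refine ⟨z a, ?_⟩
      have k := congrFun key a
      simp only [Pi.add_apply, Pi.smul_apply, smul_eq_mul] at k
      rw [← k]
      convert I.neg_mem (h1 a) using 1
      ring)
    simp only [hI1] at hw
    choose u hu using hw
    refine ⟨u, fun a => reg m (by omega) _ ?_⟩
    have h2 := mv I (MD ρ (j + 1))
      ((MH ρ m (j + 1)).mulVec z - (MD ρ (j + 1 + 1)).mulVec w - fF ρ m • u) hu a
    have k := congrFun key a
    rw [Matrix.mulVec_sub, Matrix.mulVec_sub, Matrix.mulVec_mulVec _ (MD ρ (j + 1)) (MD ρ (j + 1 + 1)),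
      MD_mul, Matrix.zero_mulVec, Matrix.mulVec_smul] at h2
    simp only [Pi.add_apply, Pi.sub_apply, Pi.smul_apply, Pi.zero_apply, smul_eq_mul] at k h2 ⊢
    convert I.add_mem h2 (h1 a) using 1
    linear_combination -k

end sem

/-! ### A regular sequence via leading monomials -/

section grob
open MvPolynomial
open scoped MonomialOrder

/-- type synonym for the weighted order -/
def WS (σ : Type*) (_m : MonomialOrder σ) (_w : σ → ℕ) : Type _ := σ →₀ ℕ

instance (σ : Type*) (m : MonomialOrder σ) (w : σ → ℕ) : AddCommMonoid (WS σ m w) :=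
  inferInstanceAs (AddCommMonoid (σ →₀ ℕ))

def WS.key {σ : Type*} {m : MonomialOrder σ} {w : σ → ℕ} (d : WS σ m w) : ℕ ×ₗ m.syn :=
  toLex (Finsupp.weight w (d : σ →₀ ℕ), m.toSyn (d : σ →₀ ℕ))

theorem WS.key_inj {σ : Type*} {m : MonomialOrder σ} {w : σ → ℕ} :
    Function.Injective (WS.key (m := m) (w := w)) := by
  intro a b h
  have h := congrArg (fun x => (ofLex x).2) h
  exact m.toSyn.injective h

theorem WS.key_add {σ : Type*} {m : MonomialOrder σ} {w : σ → ℕ} (a b : WS σ m w) :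
    (a + b).key = a.key + b.key := by
  have h1 := map_add (Finsupp.weight w) (a : σ →₀ ℕ) (b : σ →₀ ℕ)
  have h2 := map_add m.toSyn (a : σ →₀ ℕ) (b : σ →₀ ℕ)
  exact congrArg toLex (Prod.ext h1 h2)

instance (σ : Type*) (m : MonomialOrder σ) (w : σ → ℕ) : LinearOrder (WS σ m w) :=
  LinearOrder.lift' WS.key WS.key_inj

theorem exists_weighted (σ : Type) (m : MonomialOrder.{0, 0} σ) (w : σ → ℕ) :
    ∃ M : MonomialOrder.{0, 0} σ, ∀ a b : σ →₀ ℕ,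
      Finsupp.weight w a < Finsupp.weight w b → a ≺[M] b := by
  refine ⟨{
    syn := WS σ m w
    isOrderedAddMonoid_syn := ⟨?_, ?_⟩
    toSyn := {
      toFun := fun d => d
      invFun := fun d => d
      left_inv := fun _ => rfl
      right_inv := fun _ => rfl
      map_add' := fun _ _ => rfl }
    toSyn_monotone := ?_
    wellFoundedLT_syn := ⟨?_⟩ }, ?_⟩
  · intro a b h c
    change (a + c).key ≤ (b + c).key
    rw [WS.key_add, WS.key_add]
    have h : a.key ≤ b.key := h
    gcongr
  · intro a b h c
    change (c + a).key ≤ (c + b).key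
    rw [WS.key_add, WS.key_add]
    have h : a.key ≤ b.key := h
    gcongr
  · intro a b h
    change WS.key (m := m) (w := w) a ≤ WS.key (m := m) (w := w) b
    obtain ⟨c, rfl⟩ := exists_add_of_le h
    have := WS.key_add (m := m) (w := w) a c
    unfold WS.key
    rw [Prod.Lex.toLex_le_toLex]
    simp only [map_add]
    by_cases hc : Finsupp.weight w c = 0
    · right
      refine ⟨by omega, ?_⟩
      exact m.le_add_right a c
    · left; omega
  · exact InvImage.wf (WS.key (m := m) (w := w)) wellFounded_lt
  · intro a b h
    change WS.key (m := m) (w := w) a < WS.key (m := m) (w := w) b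
    unfold WS.key
    rw [Prod.Lex.toLex_lt_toLex]
    exact Or.inl h

theorem exists_order (σ : Type) [Finite σ] (w : σ → ℕ) :
    ∃ M : MonomialOrder.{0, 0} σ, ∀ a b : σ →₀ ℕ,
      Finsupp.weight w a < Finsupp.weight w b → a ≺[M] b := by
  classical
  let _ : LinearOrder σ := linearOrderOfSTO WellOrderingRel
  exact exists_weighted σ MonomialOrder.lex w

variable {σ K : Type*} [Field K] (M : MonomialOrder σ)

theorem grob_red (f : ℕ → MvPolynomial σ K) (n : ℕ) (hf : ∀ i < n, f i ≠ 0)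
    (g : MvPolynomial σ K) : ∃ g0, g - g0 ∈ Ideal.span (f '' {i | i < n}) ∧
      (g0 ≠ 0 → ∀ i < n, ¬ M.degree (f i) ≤ M.degree g0) := by
  obtain ⟨q, r, h1, -, h3⟩ := M.div_set (B := f '' {i | i < n}) (by
    rintro _ ⟨i, hi, rfl⟩
    exact (M.leadingCoeff_ne_zero_iff.2 (hf i hi)).isUnit) g
  refine ⟨r, ?_, ?_⟩
  · rw [h1, add_sub_cancel_right, Finsupp.linearCombination_apply]
    exact Ideal.sum_mem _ fun b _ => Ideal.mul_mem_left _ _ (Ideal.subset_span b.2)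
  · intro hr i hi
    exact h3 _ (M.degree_mem_support hr) _ ⟨i, hi, rfl⟩

theorem cop_le {a c d : σ →₀ ℕ} (h : ∀ s, a s = 0 ∨ d s = 0) (hle : a ≤ c + d) : a ≤ c := by
  intro s
  have := hle s
  simp only [Finsupp.add_apply] at this
  rcases h s with h | h <;> omega

theorem grob_lead (f : ℕ → MvPolynomial σ K) (N : ℕ) (hf : ∀ i < N, f i ≠ 0)
    (hcop : ∀ i < N, ∀ j < N, i ≠ j → ∀ s, M.degree (f i) s = 0 ∨ M.degree (f j) s = 0)
    (n : ℕ) (hn : n ≤ N) :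
    (∀ h ∈ Ideal.span (f '' {i | i < n}), h ≠ 0 → ∃ i < n, M.degree (f i) ≤ M.degree h) := by
  induction n with
  | zero => intro h hh; simp at hh; intro h0; exact absurd hh h0
  | succ n ih =>
    have ih := ih (by omega)
    intro h hh h0
    have : {i | i < n + 1} = insert n {i | i < n} := by ext i; simp; omega
    rw [this, Set.image_insert_eq, Ideal.mem_span_insert] at hh
    obtain ⟨g, t, ht, rfl⟩ := hh
    obtain ⟨g0, hg1, hg2⟩ := grob_red M f n (fun i hi => hf i (by omega)) g
    have ht' : (g - g0) * f n + t ∈ Ideal.span (f '' {i | i < n}) :=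
      Ideal.add_mem _ (Ideal.mul_mem_right _ _ hg1) ht
    set t' := (g - g0) * f n + t with ht'd
    have e : g * f n + t = g0 * f n + t' := by rw [ht'd]; ring
    rw [e] at h0 ⊢
    by_cases hg0 : g0 = 0
    · rw [hg0, zero_mul, zero_add] at h0 ⊢
      obtain ⟨i, hi, hle⟩ := ih t' ht' h0
      exact ⟨i, by omega, hle⟩
    have hfn := hf n (by omega)
    have hd := M.degree_mul hg0 hfn
    by_cases ht0 : t' = 0
    · rw [ht0, add_zero, hd]
      exact ⟨n, by omega, le_add_self⟩
    obtain ⟨i, hi, hle⟩ := ih t' ht' ht0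
    have hne : M.degree (g0 * f n) ≠ M.degree t' := by
      intro he
      rw [← he, hd] at hle
      exact hg2 hg0 i hi (cop_le (hcop i (by omega) n (by omega) (by omega)) hle)
    have hs := M.degree_add_of_ne hne
    rcases le_total (M.toSyn (M.degree (g0 * f n))) (M.toSyn (M.degree t')) with hl | hl
    · rw [sup_eq_right.2 hl] at hs
      rw [M.toSyn.injective hs]
      exact ⟨i, by omega, hle⟩
    · rw [sup_eq_left.2 hl] at hs
      rw [M.toSyn.injective hs, hd]
      exact ⟨n, by omega, le_add_self⟩

theorem grob_reg (f : ℕ → MvPolynomial σ K) (N : ℕ) (hf : ∀ i < N, f i ≠ 0)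
    (hcop : ∀ i < N, ∀ j < N, i ≠ j → ∀ s, M.degree (f i) s = 0 ∨ M.degree (f j) s = 0) :
    ∀ m < N, ∀ g, f m * g ∈ Ideal.span (f '' {i | i < m}) → g ∈ Ideal.span (f '' {i | i < m}) := by
  intro m hm g hg
  obtain ⟨g0, hg1, hg2⟩ := grob_red M f m (fun i hi => hf i (by omega)) g
  by_cases hg0 : g0 = 0
  · simpa [hg0] using hg1
  exfalso
  have h1 : g0 * f m ∈ Ideal.span (f '' {i | i < m}) := by
    have := Ideal.sub_mem _ hg (Ideal.mul_mem_left _ (f m) hg1)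
    convert this using 1; ring
  obtain ⟨i, hi, hle⟩ := grob_lead M f N hf hcop m hm.le _ h1 (mul_ne_zero hg0 (hf m hm))
  rw [M.degree_mul hg0 (hf m hm)] at hle
  exact hg2 hg0 i hi (cop_le (hcop i (by omega) m hm (by omega)) hle)

theorem lead_of (w : σ → ℕ) (hM : ∀ a b : σ →₀ ℕ,
      Finsupp.weight w a < Finsupp.weight w b → a ≺[M] b)
    (d : σ →₀ ℕ) (c : K) (hc : c ≠ 0) (g : MvPolynomial σ K)
    (hg : ∀ e ∈ g.support, Finsupp.weight w e < Finsupp.weight w d) :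
    monomial d c + g ≠ 0 ∧ M.degree (monomial d c + g) = d := by
  classical
  have hd : M.degree (monomial d c) = d := by rw [M.degree_monomial, if_neg hc]
  have h0 : coeff d (monomial d c + g) ≠ 0 := by
    have : coeff d g = 0 := by
      by_contra h
      exact lt_irrefl _ (hg d (mem_support_iff.2 h))
    rw [coeff_add, this, coeff_monomial, if_pos rfl, add_zero]
    exact hc
  refine ⟨fun h => h0 (by rw [h, coeff_zero]), ?_⟩
  apply M.toSyn.injective
  apply le_antisymm
  · rw [M.degree_le_iff]
    intro e he
    rcases Finset.mem_union.1 (support_add he) with h | h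
    · rw [Finset.mem_singleton.1 (support_monomial_subset h)]
    · exact (hM _ _ (hg e h)).le
  · exact M.le_degree (mem_support_iff.2 h0)

theorem wl_add {w : σ → ℕ} {n : ℕ} {g h : MvPolynomial σ K}
    (hg : ∀ e ∈ g.support, Finsupp.weight w e < n) (hh : ∀ e ∈ h.support, Finsupp.weight w e < n) :
    ∀ e ∈ (g + h).support, Finsupp.weight w e < n := by
  classical
  intro e he
  rcases Finset.mem_union.1 (support_add he) with h | h
  · exact hg e h
  · exact hh e h

theorem wl_mon {w : σ → ℕ} {n : ℕ} (d : σ →₀ ℕ) (c : K) (h : Finsupp.weight w d < n) :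
    ∀ e ∈ (monomial d c).support, Finsupp.weight w e < n := by
  intro e he
  rwa [Finset.mem_singleton.1 (support_monomial_subset he)]

end grob

section final
open MvPolynomial

def vars17 : ℕ → sig17
  | 0 => Sum.inl ()
  | 1 => Sum.inr (Sum.inl (0, 0))
  | 2 => Sum.inr (Sum.inl (0, 1))
  | 3 => Sum.inr (Sum.inl (1, 0))
  | 4 => Sum.inr (Sum.inl (1, 1))
  | 5 => Sum.inr (Sum.inl (2, 0))
  | 6 => Sum.inr (Sum.inl (2, 1))
  | 7 => Sum.inr (Sum.inl (3, 0))
  | 8 => Sum.inr (Sum.inl (3, 1))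
  | 9 => Sum.inr (Sum.inr (0, 0))
  | 10 => Sum.inr (Sum.inr (0, 1))
  | 11 => Sum.inr (Sum.inr (0, 2))
  | 12 => Sum.inr (Sum.inr (0, 3))
  | 13 => Sum.inr (Sum.inr (1, 0))
  | 14 => Sum.inr (Sum.inr (1, 1))
  | 15 => Sum.inr (Sum.inr (1, 2))
  | 16 => Sum.inr (Sum.inr (1, 3))
  | _ => Sum.inl ()

def rho17 (K : Type*) [Field K] (n : ℕ) : P17 K := X (vars17 n)

/-- the weights -/
def wt17 : sig17 → ℕ
  | Sum.inl _ => 0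
  | Sum.inr (Sum.inl (j, k)) => !![10, 0; 0, 10; 10, 0; 0, 10] j k
  | Sum.inr (Sum.inr (i, j)) => !![13, 11, 12, 10; 10, 12, 11, 13] i j

/-- exponent vector -/
def ex17 (l : List ℕ) : sig17 →₀ ℕ := (l.map fun n => Finsupp.single (vars17 n) 1).sum

theorem evM_rho (K : Type*) [Field K] (c : ℤ) (l : List ℕ) :
    (c : P17 K) * evM (rho17 K) l = monomial (ex17 l) (c : K) := by
  induction l with
  | nil => simp [evM, ex17]
  | cons a l ih =>
    have h1 : evM (rho17 K) (a :: l) = X (vars17 a) * evM (rho17 K) l := by simp [evM, rho17]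
    have h2 : ex17 (a :: l) = Finsupp.single (vars17 a) 1 + ex17 l := by simp [ex17]
    rw [h1, h2, mul_left_comm, ih, X, monomial_mul, one_mul]

theorem wt_ex17 (l : List ℕ) :
    Finsupp.weight wt17 (ex17 l) = (l.map fun n => wt17 (vars17 n)).sum := by
  induction l with
  | nil => simp [ex17]
  | cons a l ih =>
    have h2 : ex17 (a :: l) = Finsupp.single (vars17 a) 1 + ex17 l := by simp [ex17]
    rw [h2, map_add, ih]
    simp [Finsupp.weight_single]

def lm17 : ℕ → List ℕ
  | 0 => [1, 9]
  | 1 => [8, 16]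
  | 2 => [4, 10]
  | 3 => [5, 15]
  | _ => [11, 14]

theorem ex17_cop : ∀ i < 5, ∀ j < 5, i ≠ j → ∀ s, ex17 (lm17 i) s = 0 ∨ ex17 (lm17 j) s = 0 := by
  have h : ∀ l s, (∀ n ∈ l, vars17 n ≠ s) → ex17 l s = 0 := by
    intro l s hl
    induction l with
    | nil => simp [ex17]
    | cons a l ih =>
      have h2 : ex17 (a :: l) = Finsupp.single (vars17 a) 1 + ex17 l := by simp [ex17]
      rw [h2, Finsupp.add_apply, ih (fun n hn => hl n (List.mem_cons_of_mem _ hn)),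
        Finsupp.single_apply, if_neg (hl a List.mem_cons_self)]
  have h2 : ∀ i j : Fin 5, i ≠ j → ∀ s : sig17, ((lm17 i).all fun n => vars17 n ≠ s) = true ∨
      ((lm17 j).all fun n => vars17 n ≠ s) = true := by decide +kernel
  intro i hi j hj hij s
  refine (h2 ⟨i, hi⟩ ⟨j, hj⟩ (fun h => hij (congrArg Fin.val h)) s).imp
    (fun hh => h _ _ ?_) (fun hh => h _ _ ?_)
  · simpa using hh
  · simpa using hh

theorem fF_lead (K : Type*) [Field K] (M : MonomialOrder.{0, 0} sig17)
    (hM : ∀ a b : sig17 →₀ ℕ,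
      Finsupp.weight wt17 a < Finsupp.weight wt17 b → M.toSyn a < M.toSyn b) :
    ∀ i < 5, fF (rho17 K) i ≠ 0 ∧ M.degree (fF (rho17 K) i) = ex17 (lm17 i) := by
  have key : ∀ (c : ℤ) (hc : (c : K) ≠ 0) (l l1 l2 l3 : List ℕ) (c1 c2 c3 : ℤ) (F : P17 K),
      F = monomial (ex17 l) (c : K) + (monomial (ex17 l1) (c1 : K) + (monomial (ex17 l2) (c2 : K)
        + monomial (ex17 l3) (c3 : K))) →
      (l1.map fun n => wt17 (vars17 n)).sum < (l.map fun n => wt17 (vars17 n)).sum →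
      (l2.map fun n => wt17 (vars17 n)).sum < (l.map fun n => wt17 (vars17 n)).sum →
      (l3.map fun n => wt17 (vars17 n)).sum < (l.map fun n => wt17 (vars17 n)).sum →
      F ≠ 0 ∧ M.degree F = ex17 l := by
    intro c hc l l1 l2 l3 c1 c2 c3 F hF h1 h2 h3
    rw [hF]
    simp only [← wt_ex17] at h1 h2 h3
    exact lead_of M wt17 hM _ _ hc _ (wl_add (wl_mon _ _ h1) (wl_add (wl_mon _ _ h2) (wl_mon _ _ h3)))
  intro i hi
  interval_cases i
  · refine key 1 (by simp) [1, 9] [3, 10] [5, 11] [7, 12] 1 1 1 _ ?_ ?_ ?_ ?_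
    · simp only [fF, cF, evM_rho, List.map_cons, List.map_nil, List.sum_cons, List.sum_nil]; ring
    all_goals decide +kernel
  · refine key 1 (by simp) [8, 16] [2, 13] [4, 14] [6, 15] 1 1 1 _ ?_ ?_ ?_ ?_
    · simp only [fF, cF, evM_rho, List.map_cons, List.map_nil, List.sum_cons, List.sum_nil]; ring
    all_goals decide +kernel
  · refine key 1 (by simp) [4, 10] [2, 9] [6, 11] [8, 12] 1 1 1 _ ?_ ?_ ?_ ?_
    · simp only [fF, cF, evM_rho, List.map_cons, List.map_nil, List.sum_cons, List.sum_nil]; ring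
    all_goals decide +kernel
  · refine key 1 (by simp) [5, 15] [1, 13] [3, 14] [7, 16] 1 1 1 _ ?_ ?_ ?_ ?_
    · simp only [fF, cF, evM_rho, List.map_cons, List.map_nil, List.sum_cons, List.sum_nil]; ring
    all_goals decide +kernel
  · refine key (-1) (by simp) [11, 14] [10, 15] [0, 1, 8] [0, 2, 7] 1 1 (-1) _ ?_ ?_ ?_ ?_
    · simp only [fF, cF, evM_rho, List.map_cons, List.map_nil, List.sum_cons, List.sum_nil]; ring
    all_goals decide +kernel

theorem reg17 (K : Type*) [Field K] : ∀ m < 5, ∀ g : P17 K,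
      fF (rho17 K) m * g ∈ Ideal.span ((fF (rho17 K)) '' {i | i < m}) →
      g ∈ Ideal.span ((fF (rho17 K)) '' {i | i < m}) := by
  obtain ⟨M, hM⟩ := exists_order sig17 wt17
  have h := fF_lead K M hM
  refine grob_reg M (fF (rho17 K)) 5 (fun i hi => (h i hi).1) ?_
  intro i hi j hj hij s
  rw [(h i hi).2, (h j hj).2]
  exact ex17_cop i hi j hj hij s

theorem exact17 (K : Type*) [Field K] (i : ℕ) :
    LinearMap.ker (MD (rho17 K) i).mulVecLin = LinearMap.range (MD (rho17 K) (i + 1)).mulVecLin := by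
  apply le_antisymm
  · intro z hz
    rw [LinearMap.mem_ker, Matrix.mulVecLin_apply] at hz
    obtain ⟨w, hw⟩ := chain (rho17 K) (reg17 K) 5 0 i (by omega) (by omega) z (by
      intro a; rw [hz]; simp)
    refine ⟨w, ?_⟩
    rw [Matrix.mulVecLin_apply]
    ext1 a
    have := hw a
    simp only [not_lt_zero, Set.ofPred_false, Set.image_empty, Ideal.span_empty, Ideal.mem_bot,
      Pi.sub_apply] at this
    exact (sub_eq_zero.1 this).symm
  · rintro _ ⟨w, rfl⟩
    rw [LinearMap.mem_ker, Matrix.mulVecLin_apply, Matrix.mulVecLin_apply, Matrix.mulVec_mulVec,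
      MD_mul, Matrix.zero_mulVec]

theorem min17 (K : Type*) [Field K] (i : ℕ) (a : Fin (r17 (i + 1))) (b : Fin (r17 i)) :
    (MD (rho17 K) i).mulVecLin (Pi.single a 1) b ∈
            Ideal.span (Set.range (MvPolynomial.X : sig17 → P17 K)) := by
  rw [Matrix.mulVecLin_apply, Matrix.mulVec_single_one]
  change ent (rho17 K) (cD i) b a ∈ _
  by_cases hi : i < 5
  swap
  · have := r17_big (i + 1) (by omega)
    exact absurd a.2 (by omega)
  have h := List.all_eq_true.1 chk_min i (List.mem_range.2 hi)
  unfold ent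
  by_cases hc : (a : ℕ) < (cD i).length
  swap
  · rw [List.getD_eq_default _ _ (not_lt.1 hc)]
    simp [evT]
  have h2 := List.all_eq_true.1 h ((cD i).getD a []) (by
        rw [List.getD_eq_getElem _ _ hc]; exact List.getElem_mem hc)
  generalize (cD i).getD a [] = l at h2
  induction l with
  | nil => simp [evT]
  | cons t l ih =>
    simp only [List.all_cons, Bool.and_eq_true] at h2
    rw [evT_cons]
    refine Ideal.add_mem _ ?_ (ih h2.2)
    split_ifs
    · obtain ⟨t1, t2, t3⟩ := t
      cases t3 with
      | nil => simp at h2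
      | cons p q =>
        refine Ideal.mul_mem_left _ _ ?_
        simp only [evM, List.map_cons, List.prod_cons]
        exact Ideal.mul_mem_right _ _ (Ideal.subset_span ⟨vars17 p, rfl⟩)
    · exact Ideal.zero_mem _


/-- the generator attached to a pair of embeddings -/
theorem gen17 (K : Type*) [Field K] (A : Finset (Fin 4)) (hA : A.card = 2) (hA' : Aᶜ.card = 2)
    (p q p' q' : Fin 4) (h : p < q) (h' : p' < q') (e : A = {p, q}) (e' : Aᶜ = {p', q'})
    (n : ℕ) (hn : (Finset.univ.filter
      (fun p : Fin 4 × Fin 4 => p.1 ∈ A ∧ p.2 ∉ A ∧ p.1 < p.2)).card = n) :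
    ((X17 K).submatrix id (fun t : Fin 2 => ((Aᶜ.orderIsoOfFin hA') t : Fin 4))).det +
          nabla17 K A * b17 K *
            ((V17 K).submatrix (fun t : Fin 2 => ((A.orderIsoOfFin hA) t : Fin 4)) id).det =
    (X17 K 0 p' * X17 K 1 q' - X17 K 0 q' * X17 K 1 p') +
      (-1) ^ n * b17 K * (V17 K p 0 * V17 K q 1 - V17 K p 1 * V17 K q 0) := by
  have key : ∀ (B : Finset (Fin 4)) (hB : B.card = 2) (p q : Fin 4), p < q → B = {p, q} →
      ((B.orderIsoOfFin hB 0 : Fin 4) = p ∧ (B.orderIsoOfFin hB 1 : Fin 4) = q) := by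
    intro B hB p q h e
    have h1 := Finset.orderEmbOfFin_unique hB (f := ![p, q]) (by
      intro x; fin_cases x <;> simp [e]) (by
      intro x y hxy; fin_cases x <;> fin_cases y <;> simp_all)
    simp only [Finset.coe_orderIsoOfFin_apply, ← h1]
    simp
  obtain ⟨k1, k2⟩ := key A hA p q h e
  obtain ⟨k3, k4⟩ := key Aᶜ hA' p' q' h' e'
  rw [Matrix.det_fin_two, Matrix.det_fin_two]
  simp only [Matrix.submatrix_apply, id, k1, k2, k3, k4, nabla17, hn]

theorem cols17 (K : Type*) [Field K] (a : Fin (r17 0)) (c : Fin (r17 1)) :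
    MD (rho17 K) 0 a c ∈ J17 K := by
  have ha : a = (0 : Fin 1) := Subsingleton.elim (α := Fin 1) _ _
  subst ha
  have hXV : ∀ i k, (X17 K * V17 K) i k ∈ J17 K := fun i k =>
    Ideal.mem_sup_left (Ideal.subset_span ⟨i, k, rfl⟩)
  have hm : ∀ (p q p' q' : Fin 4) (n : ℕ), p < q → p' < q' → ({p, q} : Finset (Fin 4))ᶜ = {p', q'} →
      (Finset.univ.filter (fun r : Fin 4 × Fin 4 =>
        r.1 ∈ ({p, q} : Finset (Fin 4)) ∧ r.2 ∉ ({p, q} : Finset (Fin 4)) ∧ r.1 < r.2)).card = n →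
      (X17 K 0 p' * X17 K 1 q' - X17 K 0 q' * X17 K 1 p') +
      (-1) ^ n * b17 K * (V17 K p 0 * V17 K q 1 - V17 K p 1 * V17 K q 0) ∈ J17 K := by
    intro p q p' q' n h h' e hn
    have hA : ({p, q} : Finset (Fin 4)).card = 2 := Finset.card_pair h.ne
    have hA' : ({p, q} : Finset (Fin 4))ᶜ.card = 2 := by rw [e]; exact Finset.card_pair h'.ne
    rw [← gen17 K _ hA hA' p q p' q' h h' rfl e n hn]
    exact Ideal.mem_sup_right (Ideal.subset_span ⟨_, hA, rfl⟩)
  have c' : ∀ c : Fin 10, MD (rho17 K) 0 (0 : Fin 1) c ∈ J17 K := by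
    intro c
    fin_cases c
    · convert hXV 0 0 using 1
      simp [MD, ent, cD, cD0, evT, evM, rho17, vars17, Matrix.mul_apply, Fin.sum_univ_four, X17, V17]
      ring
    · convert hXV 0 1 using 1
      simp [MD, ent, cD, cD0, evT, evM, rho17, vars17, Matrix.mul_apply, Fin.sum_univ_four, X17, V17]
      ring
    · convert hXV 1 0 using 1
      simp [MD, ent, cD, cD0, evT, evM, rho17, vars17, Matrix.mul_apply, Fin.sum_univ_four, X17, V17]
      ring
    · convert hXV 1 1 using 1
      simp [MD, ent, cD, cD0, evT, evM, rho17, vars17, Matrix.mul_apply, Fin.sum_univ_four, X17, V17]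
      ring
    · convert hm 0 1 2 3 4 (by decide) (by decide) (by decide) (by decide) using 1
      simp [MD, ent, cD, cD0, evT, evM, rho17, vars17, X17, V17, b17]
      ring
    · convert hm 0 2 1 3 3 (by decide) (by decide) (by decide) (by decide) using 1
      simp [MD, ent, cD, cD0, evT, evM, rho17, vars17, X17, V17, b17]
      ring
    · convert hm 0 3 1 2 2 (by decide) (by decide) (by decide) (by decide) using 1
      simp [MD, ent, cD, cD0, evT, evM, rho17, vars17, X17, V17, b17]
      ring
    · convert hm 1 2 0 3 2 (by decide) (by decide) (by decide) (by decide) using 1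
      simp [MD, ent, cD, cD0, evT, evM, rho17, vars17, X17, V17, b17]
      ring
    · convert hm 1 3 0 2 1 (by decide) (by decide) (by decide) (by decide) using 1
      simp [MD, ent, cD, cD0, evT, evM, rho17, vars17, X17, V17, b17]
      ring
    · convert hm 2 3 0 1 0 (by decide) (by decide) (by decide) (by decide) using 1
      simp [MD, ent, cD, cD0, evT, evM, rho17, vars17, X17, V17, b17]
      ring
  exact c' c

theorem le17 (K : Type*) [Field K] :
    J17 K ≤ Ideal.span (Set.range fun c : Fin 10 => MD (rho17 K) 0 (0 : Fin 1) c) := by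
  refine sup_le (Ideal.span_le.2 ?_) (Ideal.span_le.2 ?_)
  · rintro _ ⟨i, k, rfl⟩
    apply Ideal.subset_span
    refine ⟨⟨2 * i + k, by omega⟩, ?_⟩
    fin_cases i <;> fin_cases k <;>
    · simp [MD, ent, cD, cD0, evT, evM, rho17, vars17, Matrix.mul_apply, Fin.sum_univ_four, X17, V17]
      ring
  · rintro _ ⟨A, hA, rfl⟩
    have hc : ∀ A : Finset (Fin 4), A.card = 2 → A = {0, 1} ∨ A = {0, 2} ∨ A = {0, 3} ∨
      A = {1, 2} ∨ A = {1, 3} ∨ A = {2, 3} := by decide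
    apply Ideal.subset_span
    rcases hc A hA with rfl | rfl | rfl | rfl | rfl | rfl
    · rw [gen17 K _ _ _ 0 1 2 3 (by decide) (by decide) (by decide) (by decide) 4 (by decide)]
      refine ⟨4, ?_⟩
      simp [MD, ent, cD, cD0, evT, evM, rho17, vars17, X17, V17, b17]
      ring
    · rw [gen17 K _ _ _ 0 2 1 3 (by decide) (by decide) (by decide) (by decide) 3 (by decide)]
      refine ⟨5, ?_⟩
      simp [MD, ent, cD, cD0, evT, evM, rho17, vars17, X17, V17, b17]
      ring
    · rw [gen17 K _ _ _ 0 3 1 2 (by decide) (by decide) (by decide) (by decide) 2 (by decide)]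
      refine ⟨6, ?_⟩
      simp [MD, ent, cD, cD0, evT, evM, rho17, vars17, X17, V17, b17]
      ring
    · rw [gen17 K _ _ _ 1 2 0 3 (by decide) (by decide) (by decide) (by decide) 2 (by decide)]
      refine ⟨7, ?_⟩
      simp [MD, ent, cD, cD0, evT, evM, rho17, vars17, X17, V17, b17]
      ring
    · rw [gen17 K _ _ _ 1 3 0 2 (by decide) (by decide) (by decide) (by decide) 1 (by decide)]
      refine ⟨8, ?_⟩
      simp [MD, ent, cD, cD0, evT, evM, rho17, vars17, X17, V17, b17]
      ring
    · rw [gen17 K _ _ _ 2 3 0 1 (by decide) (by decide) (by decide) (by decide) 0 (by decide)]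
      refine ⟨9, ?_⟩
      simp [MD, ent, cD, cD0, evT, evM, rho17, vars17, X17, V17, b17]
      ring

/-- the augmentation -/
def eps17 (K : Type*) [Field K] : (Fin (r17 0) → P17 K) →ₗ[P17 K] (P17 K ⧸ J17 K) :=
  (Submodule.mkQ (J17 K)).comp (LinearMap.proj (R := P17 K) (φ := fun _ : Fin (r17 0) => P17 K) (0 : Fin 1))

theorem eps17_apply (K : Type*) [Field K] (z : Fin (r17 0) → P17 K) :
    eps17 K z = Ideal.Quotient.mk (J17 K) (z (0 : Fin 1)) := rfl

theorem ker17 (K : Type*) [Field K] :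
    LinearMap.ker (eps17 K) = LinearMap.range (MD (rho17 K) 0).mulVecLin := by
  apply le_antisymm
  · intro z hz
    rw [LinearMap.mem_ker, eps17_apply, Ideal.Quotient.eq_zero_iff_mem] at hz
    obtain ⟨w, hw⟩ := (Ideal.mem_span_range_iff_exists_fun).1 (le17 K hz)
    refine ⟨w, ?_⟩
    ext1 a
    have ha : a = (0 : Fin 1) := Subsingleton.elim (α := Fin 1) _ _
    subst ha
    refine Eq.trans ?_ hw
    change ∑ c : Fin 10, MD (rho17 K) 0 (0 : Fin 1) c * w c = _
    exact Finset.sum_congr rfl fun c _ => mul_comm _ _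
  · rintro _ ⟨w, rfl⟩
    rw [LinearMap.mem_ker, eps17_apply, Ideal.Quotient.eq_zero_iff_mem]
    change ∑ c : Fin (r17 1), MD (rho17 K) 0 (0 : Fin 1) c * w c ∈ _
    exact Ideal.sum_mem _ fun c _ => Ideal.mul_mem_right _ _ (cols17 K _ c)

end final

theorem stmt_17 (K : Type*) [Field K] :
    ∃ d : ∀ i : ℕ, (Fin (r17 (i + 1)) → P17 K) →ₗ[P17 K] (Fin (r17 i) → P17 K),
      ∃ ε : (Fin (r17 0) → P17 K) →ₗ[P17 K] (P17 K ⧸ J17 K),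
        Function.Surjective ε ∧
        LinearMap.ker ε = LinearMap.range (d 0) ∧
        (∀ i, LinearMap.ker (d i) = LinearMap.range (d (i + 1))) ∧
        (∀ (i : ℕ) (a : Fin (r17 (i + 1))) (b : Fin (r17 i)),
          d i (Pi.single a 1) b ∈
            Ideal.span (Set.range (MvPolynomial.X : sig17 → P17 K))) := by
  refine ⟨fun i => (MD (rho17 K) i).mulVecLin, eps17 K, ?_, ker17 K, exact17 K, min17 K⟩
  intro y
  obtain ⟨p, rfl⟩ := Ideal.Quotient.mk_surjective y
  exact ⟨fun _ => p, rfl⟩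

end
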